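/- Dual representation of the Brownian excursion, boundary case t₁ = 0: Let d ≥ 2, let 0 = s₀ < s₁ < … < s_d and 0 = t₁ < t₂ < … < t_d < 1 = t_{d+1}, and set t₀ = 0. Then (1/√(2π)) ∫_{(0,∞)^{d+1}} √(x₀) · exp(−(1/2) ∑_{k=0}^d (t_{k+1} − t_k) x_k) · ∏_{k=1}^d p_{s_k − s_{k−1}}(x_{k−1}, x_k) dx₀ dx₁ … dx_d = ∫_{(0,∞)^{d−1}} exp(−∑_{k=2}^{d} (s_k − s_{k−1}) y_k) · f_{t₂,…,t_d}(y₂,…,y_d) dy₂…dy_d (note that the coefficient t₁ − t₀ of x₀ is 0). -/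

import Mathlib

open MeasureTheory Real Finset

/-- Transition density `p_t(x,y)` of the auxiliary Markov process `X`. -/
noncomputable def transP (t x y : ℝ) : ℝ :=
  2 * t * Real.sqrt y / (Real.pi * ((y - x) ^ 2 + 2 * (x + y) * t ^ 2 + t ^ 4))

/-- The function `ℓ_t(y)`. -/
noncomputable def ellF (t y : ℝ) : ℝ :=
  if 0 < y then y * Real.exp (-(y ^ 2) / (2 * t)) / Real.sqrt (2 * Real.pi * t ^ 3) else 0

/-- The function `g_t(y₁,y₂)`. -/
noncomputable def gF (t y₁ y₂ : ℝ) : ℝ :=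
  if 0 < y₁ ∧ 0 < y₂ then
    (1 / Real.sqrt (2 * Real.pi * t)) *
      (Real.exp (-((y₁ - y₂) ^ 2) / (2 * t)) - Real.exp (-((y₁ + y₂) ^ 2) / (2 * t)))
  else 0

/-- The joint density `f_{t₁,…,t_{n+1}}(y₁,…,y_{n+1})` of the Brownian excursion
at `n+1` time points (indexed by `Fin (n+1)`). -/
noncomputable def excDensity (n : ℕ) (t y : Fin (n + 1) → ℝ) : ℝ :=
  Real.sqrt (8 * Real.pi) * ellF (t 0) (y 0) * ellF (1 - t (Fin.last n)) (y (Fin.last n)) *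
    ∏ k : Fin n, gF (t k.succ - t k.castSucc) (y k.castSucc) (y k.succ)


theorem aux_cos_exp (t a : ℝ) (ht : 0 < t) :
    IntegrableOn (fun y => Real.exp (-(t * y)) * Real.cos (a * y)) (Set.Ioi 0) ∧
    ∫ y in Set.Ioi (0:ℝ), Real.exp (-(t * y)) * Real.cos (a * y) = t / (t ^ 2 + a ^ 2) := by
  have hD : t ^ 2 + a ^ 2 ≠ 0 := by positivity
  have hint : IntegrableOn (fun y => Real.exp (-(t * y)) * Real.cos (a * y)) (Set.Ioi 0) := by
    have h1 := exp_neg_integrableOn_Ioi 0 ht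
    refine Integrable.mono' h1 (by fun_prop) (Filter.Eventually.of_forall fun y => ?_)
    rw [Real.norm_eq_abs, abs_mul, Real.abs_exp, neg_mul]
    exact mul_le_of_le_one_right (Real.exp_pos _).le (Real.abs_cos_le_one _)
  refine ⟨hint, ?_⟩
  have hlim0 : Filter.Tendsto (fun y => Real.exp (-(t * y))) Filter.atTop (nhds 0) :=
    Real.tendsto_exp_neg_atTop_nhds_zero.comp (Filter.tendsto_id.const_mul_atTop ht)
  have hlim : Filter.Tendsto (fun y => Real.exp (-(t * y)) *
      ((a * Real.sin (a * y) - t * Real.cos (a * y)) / (t ^ 2 + a ^ 2)))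
      Filter.atTop (nhds 0) := by
    refine squeeze_zero_norm (a := fun y => Real.exp (-(t * y)) *
      ((|a| + |t|) / (t ^ 2 + a ^ 2))) (fun y => ?_) ?_
    · rw [Real.norm_eq_abs, abs_mul, Real.abs_exp, abs_div, abs_of_pos (show 0 < t^2+a^2 by positivity)]
      gcongr
      refine (abs_sub _ _).trans ?_
      rw [abs_mul, abs_mul]
      exact add_le_add (mul_le_of_le_one_right (abs_nonneg _) (Real.abs_sin_le_one _))
        (mul_le_of_le_one_right (abs_nonneg _) (Real.abs_cos_le_one _))
    · simpa using hlim0.mul_const ((|a| + |t|) / (t ^ 2 + a ^ 2))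
  rw [integral_Ioi_of_hasDerivAt_of_tendsto' (m := 0) (f := fun y => Real.exp (-(t * y)) *
      ((a * Real.sin (a * y) - t * Real.cos (a * y)) / (t ^ 2 + a ^ 2))) _ hint hlim]
  · simp; field_simp
  · intro y _
    have h1 : HasDerivAt (fun y => Real.exp (-(t * y))) (Real.exp (-(t * y)) * -(t * 1)) y :=
      (((hasDerivAt_id y).const_mul t).neg).exp
    have h2 : HasDerivAt (fun y => Real.sin (a * y)) (Real.cos (a * y) * (a * 1)) y :=
      ((hasDerivAt_id y).const_mul a).sin
    have h3 : HasDerivAt (fun y => Real.cos (a * y)) (-Real.sin (a * y) * (a * 1)) y :=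
      ((hasDerivAt_id y).const_mul a).cos
    convert! h1.mul (((h2.const_mul a).sub (h3.const_mul t)).div_const (t ^ 2 + a ^ 2)) using 1
    simp only [Pi.sub_apply]
    field_simp
    ring

theorem aux_transP (t x y : ℝ) (ht : 0 < t) (hx : 0 < x) (hy : 0 < y) :
    transP t x y = (Real.pi)⁻¹ * (Real.sqrt x)⁻¹ * ∫ z in Set.Ioi (0:ℝ),
      Real.exp (-(t * z)) * (Real.sin (Real.sqrt x * z) * Real.sin (Real.sqrt y * z)) := by
  obtain ⟨u, hu, rfl⟩ : ∃ u : ℝ, 0 < u ∧ x = u ^ 2 :=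
    ⟨Real.sqrt x, Real.sqrt_pos.2 hx, (Real.sq_sqrt hx.le).symm⟩
  obtain ⟨v, hv, rfl⟩ : ∃ u : ℝ, 0 < u ∧ y = u ^ 2 :=
    ⟨Real.sqrt y, Real.sqrt_pos.2 hy, (Real.sq_sqrt hy.le).symm⟩
  rw [Real.sqrt_sq hu.le, Real.sqrt_sq hv.le]
  obtain ⟨i1, e1⟩ := aux_cos_exp t (u - v) ht
  obtain ⟨i2, e2⟩ := aux_cos_exp t (u + v) ht
  have : ∀ z, Real.exp (-(t * z)) * (Real.sin (u * z) * Real.sin (v * z)) =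
      (1/2) * (Real.exp (-(t * z)) * Real.cos ((u - v) * z) -
        Real.exp (-(t * z)) * Real.cos ((u + v) * z)) := by
    intro z
    rw [sub_mul, add_mul, Real.cos_sub, Real.cos_add]; ring
  simp_rw [this]
  rw [integral_const_mul, integral_sub i1 i2, e1, e2, transP, Real.sqrt_sq hv.le]
  have h1 : t ^ 2 + (u - v) ^ 2 ≠ 0 := by positivity
  have h2 : t ^ 2 + (u + v) ^ 2 ≠ 0 := by positivity
  have h3 : (v ^ 2 - u ^ 2) ^ 2 + 2 * (u ^ 2 + v ^ 2) * t ^ 2 + t ^ 4 =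
    (t ^ 2 + (u - v) ^ 2) * (t ^ 2 + (u + v) ^ 2) := by ring
  rw [h3]
  field_simp
  ring

theorem aux_cos_gauss (b a : ℝ) (hb : 0 < b) :
    IntegrableOn (fun u => Real.exp (-b * u ^ 2) * Real.cos (a * u)) (Set.Ioi 0) ∧
    ∫ u in Set.Ioi (0:ℝ), Real.exp (-b * u ^ 2) * Real.cos (a * u) =
      (1 / 2) * Real.sqrt (Real.pi / b) * Real.exp (-(a ^ 2) / (4 * b)) := by
  have hint : Integrable (fun u => Real.exp (-b * u ^ 2) * Real.cos (a * u)) := by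
    have h1 := integrable_exp_neg_mul_sq hb
    refine Integrable.mono' h1 (by fun_prop) (Filter.Eventually.of_forall fun y => ?_)
    rw [Real.norm_eq_abs, abs_mul, Real.abs_exp]
    exact mul_le_of_le_one_right (Real.exp_pos _).le (Real.abs_cos_le_one _)
  refine ⟨hint.integrableOn, ?_⟩
  have key := fourierIntegral_gaussian (b := (b:ℂ)) (by simpa using hb) (a : ℂ)
  have h2 := integral_comp_abs (f := fun u => Real.exp (-b * u ^ 2) * Real.cos (a * u))
  have h3 : ∀ u : ℝ, Real.exp (-b * |u| ^ 2) * Real.cos (a * |u|) =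
      Real.exp (-b * u ^ 2) * Real.cos (a * u) := by
    intro u
    rw [sq_abs]
    rcases abs_choice u with h | h <;> rw [h]
    rw [mul_neg, Real.cos_neg]
  simp_rw [h3] at h2
  have h4 : ∫ u : ℝ, Real.exp (-b * u ^ 2) * Real.cos (a * u) =
      Real.sqrt (Real.pi / b) * Real.exp (-(a ^ 2) / (4 * b)) := by
    have h5 : ∀ u : ℝ, Real.exp (-b * u ^ 2) * Real.cos (a * u) =
      RCLike.re (Complex.exp (Complex.I * a * u) * Complex.exp (-b * u ^ 2)) := by
      intro u
      have : Complex.exp (-b * u ^ 2) = ((Real.exp (-b * u ^ 2) : ℝ) : ℂ) := by push_cast; rfl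
      rw [this, show Complex.I * a * u = ((a * u : ℝ) : ℂ) * Complex.I by push_cast; ring]
      simp only [RCLike.re_to_complex, Complex.re_mul_ofReal, Complex.exp_ofReal_mul_I_re]
      ring
    simp_rw [h5]
    rw [integral_re, key]
    · have : ((Real.pi : ℂ) / b) ^ (1 / 2 : ℂ) * Complex.exp (-(a:ℂ) ^ 2 / (4 * b)) =
        ((Real.sqrt (Real.pi / b) * Real.exp (-(a ^ 2) / (4 * b)) : ℝ) : ℂ) := by
        rw [Real.sqrt_eq_rpow]
        push_cast
        rw [Complex.ofReal_cpow (by positivity)]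
        push_cast
        rfl
      rw [this, RCLike.re_to_complex, Complex.ofReal_re]
    · have h1 := integrable_exp_neg_mul_sq hb
      refine Integrable.mono' h1 (by fun_prop) (Filter.Eventually.of_forall fun y => ?_)
      rw [norm_mul, Complex.norm_exp, Complex.norm_exp]
      have : (-(b:ℂ) * y ^ 2).re = -b * y ^ 2 := by
        norm_cast
      rw [this]
      simp
  linarith

theorem aux_sin_gauss (b a : ℝ) (hb : 0 < b) :
    ∫ u in Set.Ioi (0:ℝ), u * (Real.exp (-b * u ^ 2) * Real.sin (a * u)) =
      a / (4 * b) * Real.sqrt (Real.pi / b) * Real.exp (-(a ^ 2) / (4 * b)) := by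
  obtain ⟨i1, e1⟩ := aux_cos_gauss b a hb
  have i2 : IntegrableOn (fun u => u * (Real.exp (-b * u ^ 2) * Real.sin (a * u))) (Set.Ioi 0) := by
    have h1 := (integrable_mul_exp_neg_mul_sq hb).norm.integrableOn (s := Set.Ioi 0)
    refine Integrable.mono' h1 (by fun_prop) (Filter.Eventually.of_forall fun y => ?_)
    rw [norm_mul, norm_mul, norm_mul]
    gcongr
    exact mul_le_of_le_one_right (norm_nonneg _) (Real.abs_sin_le_one _)
  have hl0 : Filter.Tendsto (fun u => Real.exp (-b * u ^ 2)) Filter.atTop (nhds 0) := by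
    have : Filter.Tendsto (fun u : ℝ => b * u ^ 2) Filter.atTop Filter.atTop :=
      (Filter.tendsto_pow_atTop two_ne_zero).const_mul_atTop hb
    simpa [Function.comp_def] using Real.tendsto_exp_neg_atTop_nhds_zero.comp this
  have hl : Filter.Tendsto (fun u => Real.sin (a * u) * Real.exp (-b * u ^ 2))
      Filter.atTop (nhds 0) := by
    refine squeeze_zero_norm (fun y => ?_) hl0
    rw [Real.norm_eq_abs, abs_mul, Real.abs_exp]
    exact mul_le_of_le_one_left (Real.exp_pos _).le (Real.abs_sin_le_one _)
  have := integral_Ioi_of_hasDerivAt_of_tendsto' (a := 0) (m := 0)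
    (f := fun u => Real.sin (a * u) * Real.exp (-b * u ^ 2))
    (f' := fun u => a * (Real.exp (-b * u ^ 2) * Real.cos (a * u)) -
      2 * b * (u * (Real.exp (-b * u ^ 2) * Real.sin (a * u)))) (fun u _ => by
      have h2 : HasDerivAt (fun y => Real.sin (a * y)) (Real.cos (a * u) * (a * 1)) u :=
        ((hasDerivAt_id u).const_mul a).sin
      have h3 : HasDerivAt (fun y => Real.exp (-b * y ^ 2))
          (Real.exp (-b * u ^ 2) * (-b * (2 * u))) u := by
        simpa using ((hasDerivAt_pow 2 u).const_mul (-b)).exp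
      convert! h2.mul h3 using 1
      ring) ((i1.const_mul a).sub (i2.const_mul (2 * b))) hl
  rw [integral_sub (i1.const_mul a) (i2.const_mul (2 * b)), integral_const_mul,
    integral_const_mul, e1] at this
  simp at this
  field_simp at this ⊢
  linarith

theorem aux_sq_subst (f : ℝ → ℝ) :
    ∫ x in Set.Ioi (0:ℝ), f (Real.sqrt x) = ∫ u in Set.Ioi (0:ℝ), 2 * (u * f u) := by
  rw [← integral_comp_rpow_Ioi_of_pos (g := fun x => f (Real.sqrt x)) (p := 2) two_pos]
  refine setIntegral_congr_fun measurableSet_Ioi fun u hu => ?_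
  have hu' : 0 < u := hu
  have h2 : u ^ (2:ℝ) = u ^ 2 := by exact_mod_cast Real.rpow_natCast u 2
  have h1 : (2:ℝ) - 1 = 1 := by norm_num
  simp only [h2, h1, Real.rpow_one, smul_eq_mul, Real.sqrt_sq hu'.le]
  ring

theorem aux_ell (δ y : ℝ) (hδ : 0 < δ) (hy : 0 < y) :
    ∫ x in Set.Ioi (0:ℝ), Real.exp (-(δ / 2 * x)) * Real.sin (Real.sqrt x * y) =
      2 * Real.pi * ellF δ y := by
  have h := aux_sq_subst (fun u => Real.exp (-(δ / 2) * u ^ 2) * Real.sin (y * u))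
  rw [integral_const_mul, aux_sin_gauss _ _ (half_pos hδ)] at h
  have h2 : ∫ x in Set.Ioi (0:ℝ), Real.exp (-(δ / 2 * x)) * Real.sin (Real.sqrt x * y) =
    ∫ x in Set.Ioi (0:ℝ), Real.exp (-(δ / 2) * (Real.sqrt x) ^ 2) * Real.sin (y * Real.sqrt x) := by
    refine setIntegral_congr_fun measurableSet_Ioi fun x hx => ?_
    have hx' : 0 < x := hx
    simp only [Real.sq_sqrt hx'.le, mul_comm y, neg_mul]
  rw [h2, h, ellF, if_pos hy]
  have e1 : Real.sqrt (Real.pi / (δ / 2)) * Real.sqrt (2 * Real.pi * δ ^ 3) =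
      2 * Real.pi * δ := by
    rw [← Real.sqrt_mul (by positivity), show Real.pi / (δ / 2) * (2 * Real.pi * δ ^ 3) =
      (2 * Real.pi * δ) ^ 2 by field_simp, Real.sqrt_sq (by positivity)]
  have e2 : 0 < Real.sqrt (2 * Real.pi * δ ^ 3) := by positivity
  rw [show 4 * (δ / 2) = 2 * δ by ring]
  have e3 : Real.sqrt (Real.pi / (δ / 2)) = 2 * Real.pi * δ / Real.sqrt (2 * Real.pi * δ ^ 3) :=
    (eq_div_iff e2.ne').2 e1
  rw [e3]
  field_simp

theorem aux_g (δ y z : ℝ) (hδ : 0 < δ) (hy : 0 < y) (hz : 0 < z) :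
    ∫ x in Set.Ioi (0:ℝ), Real.exp (-(δ / 2 * x)) * (Real.sqrt x)⁻¹ *
      (Real.sin (Real.sqrt x * y) * Real.sin (Real.sqrt x * z)) =
      Real.pi * gF δ y z := by
  have h := aux_sq_subst (fun u => Real.exp (-(δ / 2) * u ^ 2) * u⁻¹ *
    (Real.sin (u * y) * Real.sin (u * z)))
  obtain ⟨i1, e1⟩ := aux_cos_gauss (δ / 2) (y - z) (half_pos hδ)
  obtain ⟨i2, e2⟩ := aux_cos_gauss (δ / 2) (y + z) (half_pos hδ)
  have h2 : ∫ x in Set.Ioi (0:ℝ), Real.exp (-(δ / 2 * x)) * (Real.sqrt x)⁻¹ *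
      (Real.sin (Real.sqrt x * y) * Real.sin (Real.sqrt x * z)) =
    ∫ x in Set.Ioi (0:ℝ), Real.exp (-(δ / 2) * (Real.sqrt x) ^ 2) * (Real.sqrt x)⁻¹ *
    (Real.sin (Real.sqrt x * y) * Real.sin (Real.sqrt x * z)) := by
    refine setIntegral_congr_fun measurableSet_Ioi fun x hx => ?_
    have hx' : 0 < x := hx
    simp only [Real.sq_sqrt hx'.le, neg_mul]
  have h3 : ∫ u in Set.Ioi (0:ℝ), 2 * (u * (Real.exp (-(δ / 2) * u ^ 2) * u⁻¹ *
    (Real.sin (u * y) * Real.sin (u * z)))) =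
    ∫ u in Set.Ioi (0:ℝ), (Real.exp (-(δ / 2) * u ^ 2) * Real.cos ((y - z) * u) -
      Real.exp (-(δ / 2) * u ^ 2) * Real.cos ((y + z) * u)) := by
    refine setIntegral_congr_fun measurableSet_Ioi fun x hx => ?_
    have hx' : 0 < x := hx
    simp only [sub_mul, add_mul, Real.cos_sub, Real.cos_add]
    field_simp
    ring
  rw [h2, h, h3, integral_sub i1 i2, e1, e2, gF, if_pos ⟨hy, hz⟩]
  have e1 : Real.sqrt (Real.pi / (δ / 2)) * Real.sqrt (2 * Real.pi * δ) =
      2 * Real.pi := by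
    rw [← Real.sqrt_mul (by positivity), show Real.pi / (δ / 2) * (2 * Real.pi * δ) =
      (2 * Real.pi) ^ 2 by field_simp, Real.sqrt_sq (by positivity)]
  have e2 : 0 < Real.sqrt (2 * Real.pi * δ) := by positivity
  rw [show 4 * (δ / 2) = 2 * δ by ring]
  have e3 : Real.sqrt (Real.pi / (δ / 2)) = 2 * Real.pi / Real.sqrt (2 * Real.pi * δ) :=
    (eq_div_iff e2.ne').2 e1
  rw [e3]
  ring

theorem aux_symm (t x y : ℝ) :
    Real.sqrt x * transP t x y = Real.sqrt y * transP t y x := by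
  unfold transP
  rw [show (x - y) ^ 2 + 2 * (y + x) * t ^ 2 + t ^ 4 =
    (y - x) ^ 2 + 2 * (x + y) * t ^ 2 + t ^ 4 by ring]
  ring

theorem aux_total (t y : ℝ) (ht : 0 < t) (hy : 0 < y) :
    IntegrableOn (fun x => transP t y x) (Set.Ioi 0) ∧
    ∫ x in Set.Ioi (0:ℝ), transP t y x = 1 := by
  obtain ⟨v, hv, rfl⟩ : ∃ u : ℝ, 0 < u ∧ y = u ^ 2 :=
    ⟨Real.sqrt y, Real.sqrt_pos.2 hy, (Real.sq_sqrt hy.le).symm⟩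
  set F : ℝ → ℝ := fun u => (Real.pi * v)⁻¹ * (t / 2 * (Real.log (t ^ 2 + (u - v) ^ 2) -
    Real.log (t ^ 2 + (u + v) ^ 2)) +
    v * (Real.arctan ((u - v) / t) + Real.arctan ((u + v) / t))) with hF
  have hp1 : ∀ u, t ^ 2 + (u - v) ^ 2 ≠ 0 := fun u => by positivity
  have hp2 : ∀ u, t ^ 2 + (u + v) ^ 2 ≠ 0 := fun u => by positivity
  have hder : ∀ u, HasDerivAt F ((Real.pi * v)⁻¹ * (t / 2 * (2 * (u - v) / (t ^ 2 + (u - v) ^ 2) -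
      2 * (u + v) / (t ^ 2 + (u + v) ^ 2)) + v * (1 / (1 + ((u - v) / t) ^ 2) * (1 / t) +
      1 / (1 + ((u + v) / t) ^ 2) * (1 / t)))) u := by
    intro u
    have a1 : HasDerivAt (fun u => u - v) 1 u := (hasDerivAt_id u).sub_const v
    have a2 : HasDerivAt (fun u => u + v) 1 u := (hasDerivAt_id u).add_const v
    have b1 : HasDerivAt (fun u => t ^ 2 + (u - v) ^ 2) (2 * (u - v)) u := by
      simpa using (a1.pow 2).const_add (t ^ 2)
    have b2 : HasDerivAt (fun u => t ^ 2 + (u + v) ^ 2) (2 * (u + v)) u := by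
      simpa using (a2.pow 2).const_add (t ^ 2)
    exact ((((b1.log (hp1 u)).sub (b2.log (hp2 u))).const_mul (t / 2)).add
      (((a1.div_const t).arctan.add (a2.div_const t).arctan).const_mul v)).const_mul _
  have hcont : Continuous F := continuous_iff_continuousAt.2 fun u => (hder u).continuousAt
  have hlimF : Filter.Tendsto F Filter.atTop (nhds 1) := by
    have l1 : Filter.Tendsto (fun u : ℝ => Real.arctan ((u - v) / t)) Filter.atTop
        (nhds (Real.pi / 2)) :=
      (tendsto_nhds_of_tendsto_nhdsWithin Real.tendsto_arctan_atTop).comp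
        ((Filter.tendsto_atTop_add_const_right _ (-v) Filter.tendsto_id).atTop_div_const ht)
    have l2 : Filter.Tendsto (fun u : ℝ => Real.arctan ((u + v) / t)) Filter.atTop
        (nhds (Real.pi / 2)) :=
      (tendsto_nhds_of_tendsto_nhdsWithin Real.tendsto_arctan_atTop).comp
        ((Filter.tendsto_atTop_add_const_right _ v Filter.tendsto_id).atTop_div_const ht)
    have l3 : Filter.Tendsto (fun u : ℝ => Real.log (t ^ 2 + (u - v) ^ 2) -
        Real.log (t ^ 2 + (u + v) ^ 2)) Filter.atTop (nhds 0) := by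
      have m : Filter.Tendsto (fun u : ℝ => (t ^ 2 * (u⁻¹) ^ 2 + (1 - v * u⁻¹) ^ 2) /
          (t ^ 2 * (u⁻¹) ^ 2 + (1 + v * u⁻¹) ^ 2)) Filter.atTop (nhds
          ((t ^ 2 * 0 ^ 2 + (1 - v * 0) ^ 2) / (t ^ 2 * 0 ^ 2 + (1 + v * 0) ^ 2))) := by
        have i := tendsto_inv_atTop_zero (𝕜 := ℝ)
        exact (((i.pow 2).const_mul _).add (((i.const_mul v).const_sub 1).pow 2)).div
          (((i.pow 2).const_mul _).add (((i.const_mul v).const_add 1).pow 2)) (by norm_num)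
      have m2 := m.log (by norm_num)
      have z : Real.log ((t ^ 2 * 0 ^ 2 + (1 - v * 0) ^ 2) / (t ^ 2 * 0 ^ 2 + (1 + v * 0) ^ 2)) = 0 := by
        norm_num
      rw [z] at m2
      refine m2.congr' ?_
      filter_upwards [Filter.eventually_gt_atTop 0] with u hu
      rw [← Real.log_div (hp1 u) (hp2 u)]
      congr 1
      have := hp2 u
      have h9 : t ^ 2 * (u⁻¹) ^ 2 + (1 + v * u⁻¹) ^ 2 = (t ^ 2 + (u + v) ^ 2) / u ^ 2 := by
        field_simp
      have h10 : t ^ 2 * (u⁻¹) ^ 2 + (1 - v * u⁻¹) ^ 2 = (t ^ 2 + (u - v) ^ 2) / u ^ 2 := by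
        field_simp
      rw [h9, h10]
      field_simp
    have := ((l3.const_mul (t / 2)).add ((l1.add l2).const_mul v)).const_mul ((Real.pi * v)⁻¹)
    convert this using 2
    field_simp
    ring
  have hF0 : F 0 = 0 := by
    simp only [hF]
    rw [zero_sub, zero_add, neg_div, Real.arctan_neg]
    simp
  have hd : ∀ x ∈ Set.Ioi (0:ℝ), HasDerivAt (fun x => F (Real.sqrt x)) (transP t (v ^ 2) x) x := by
    intro x hx
    have hx' : 0 < x := hx
    have := (hder (Real.sqrt x)).comp x (Real.hasDerivAt_sqrt hx'.ne')
    convert! this using 1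
    unfold transP
    obtain ⟨u, hu, rfl⟩ : ∃ u : ℝ, 0 < u ∧ x = u ^ 2 :=
      ⟨Real.sqrt x, Real.sqrt_pos.2 hx, (Real.sq_sqrt hx'.le).symm⟩
    rw [Real.sqrt_sq hu.le]
    have q1 := hp1 u
    have q2 := hp2 u
    have q3 : 1 + ((u - v) / t) ^ 2 = (t ^ 2 + (u - v) ^ 2) / t ^ 2 := by field_simp
    have q4 : 1 + ((u + v) / t) ^ 2 = (t ^ 2 + (u + v) ^ 2) / t ^ 2 := by field_simp
    have q5 : (u ^ 2 - v ^ 2) ^ 2 + 2 * (v ^ 2 + u ^ 2) * t ^ 2 + t ^ 4 =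
      (t ^ 2 + (u - v) ^ 2) * (t ^ 2 + (u + v) ^ 2) := by ring
    rw [q3, q4, q5]
    field_simp
    ring
  have hc : ContinuousWithinAt (fun x => F (Real.sqrt x)) (Set.Ici 0) 0 :=
    (hcont.comp Real.continuous_sqrt).continuousWithinAt
  have hnn : ∀ x ∈ Set.Ioi (0:ℝ), 0 ≤ transP t (v ^ 2) x := by
    intro x hx
    have hx' : 0 < x := hx
    unfold transP
    positivity
  have hl := hlimF.comp Real.tendsto_sqrt_atTop
  refine ⟨integrableOn_Ioi_deriv_of_nonneg hc hd hnn hl, ?_⟩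
  rw [integral_Ioi_of_hasDerivAt_of_nonneg hc hd hnn hl]
  simp [hF0]

/-- Lebesgue measure on the positive half line. -/
noncomputable abbrev muPos : Measure ℝ := volume.restrict (Set.Ioi (0:ℝ))

theorem aux_ae_pos (m : ℕ) : ∀ᵐ x ∂(Measure.pi fun _ : Fin m => muPos), ∀ i, 0 < x i := by
  have h : (Measure.pi fun _ : Fin m => muPos) =
      (volume : Measure (Fin m → ℝ)).restrict (Set.univ.pi fun _ => Set.Ioi (0:ℝ)) := by
    rw [volume_pi, Measure.restrict_pi_pi]
  rw [h]
  filter_upwards [ae_restrict_mem (MeasurableSet.univ_pi fun _ => measurableSet_Ioi)] with x hx i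
  exact hx i (Set.mem_univ i)

theorem aux_prod_ends (n : ℕ) (h : Fin (n + 2) → ℝ) :
    ∏ k, h k = h 0 * (∏ k : Fin n, h k.succ.castSucc) * h (Fin.last (n + 1)) := by
  rw [Fin.prod_univ_castSucc, Fin.prod_univ_succ]
  simp

/-- The weight attached to each coordinate. -/
noncomputable def wgt (n : ℕ) (δ : ℝ) (k : Fin (n + 2)) (x : ℝ) : ℝ :=
  Real.exp (-(δ / 2 * x)) * (if k = 0 ∨ k = Fin.last (n + 1) then 1 else (Real.sqrt x)⁻¹)

theorem wgt_nonneg (n : ℕ) (δ : ℝ) (k : Fin (n + 2)) (x : ℝ) : 0 ≤ wgt n δ k x := by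
  unfold wgt
  split_ifs <;> positivity

theorem wgt_meas (n : ℕ) (δ : ℝ) (k : Fin (n + 2)) : Measurable (wgt n δ k) := by
  unfold wgt
  split_ifs <;> fun_prop

theorem wgt_int (n : ℕ) (δ : ℝ) (hδ : 0 < δ) (k : Fin (n + 2)) :
    Integrable (wgt n δ k) muPos := by
  unfold wgt
  split_ifs
  · have := exp_neg_integrableOn_Ioi 0 (half_pos hδ)
    simpa [IntegrableOn] using this
  · have := integrableOn_rpow_mul_exp_neg_mul_rpow (s := -(1/2)) (by norm_num) one_pos (half_pos hδ)
    refine Integrable.congr this ?_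
    filter_upwards [ae_restrict_mem measurableSet_Ioi] with x hx
    have hx' : 0 < x := hx
    rw [Real.rpow_one, Real.rpow_neg hx'.le, ← Real.sqrt_eq_rpow, mul_comm, neg_mul]

theorem wgt_prod (n : ℕ) (δ : Fin (n + 2) → ℝ) (x : Fin (n + 2) → ℝ) :
    ∏ k, wgt n (δ k) k (x k) = (∏ k, Real.exp (-(δ k / 2 * x k))) *
      ∏ k : Fin n, (Real.sqrt (x k.succ.castSucc))⁻¹ := by
  unfold wgt
  rw [Finset.prod_mul_distrib]
  congr 1
  rw [aux_prod_ends]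
  have h3 : ∀ k : Fin n, ¬ (k.succ.castSucc = 0 ∨ k.succ.castSucc = Fin.last (n + 1)) := by
    intro k
    simp [Fin.ext_iff]
    omega
  simp only [if_neg (h3 _), true_or, or_true, if_true, one_mul, mul_one]

/-- The joint kernel. -/
noncomputable def kerK (n : ℕ) (δ : Fin (n + 2) → ℝ) (τ : Fin (n + 1) → ℝ)
    (x : Fin (n + 2) → ℝ) (y : Fin (n + 1) → ℝ) : ℝ :=
  (∏ k, wgt n (δ k) k (x k)) * ∏ k : Fin (n + 1), (Real.exp (-(τ k * y k)) *
    (Real.sin (Real.sqrt (x k.castSucc) * y k) * Real.sin (Real.sqrt (x k.succ) * y k)))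

theorem kerK_meas (n : ℕ) (δ : Fin (n + 2) → ℝ) (τ : Fin (n + 1) → ℝ) :
    Measurable (Function.uncurry (kerK n δ τ)) := by
  unfold kerK Function.uncurry
  refine Measurable.mul ?_ ?_
  · refine Finset.measurable_prod _ fun k _ => ?_
    exact (wgt_meas n (δ k) k).comp ((measurable_pi_apply k).comp measurable_fst)
  · refine Finset.measurable_prod _ fun k _ => ?_
    fun_prop

theorem kerK_int (n : ℕ) (δ : Fin (n + 2) → ℝ) (τ : Fin (n + 1) → ℝ)
    (hδ : ∀ k, 0 < δ k) (hτ : ∀ k, 0 < τ k) :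
    Integrable (Function.uncurry (kerK n δ τ))
      ((Measure.pi fun _ : Fin (n + 2) => muPos).prod (Measure.pi fun _ : Fin (n + 1) => muPos)) := by
  have h1 : Integrable (fun x : Fin (n + 2) → ℝ => ∏ k, wgt n (δ k) k (x k))
      (Measure.pi fun _ : Fin (n + 2) => muPos) :=
    Integrable.fintype_prod (f := fun k => wgt n (δ k) k) fun k => wgt_int n (δ k) (hδ k) k
  have h2 : Integrable (fun y : Fin (n + 1) → ℝ => ∏ k, Real.exp (-(τ k * y k)))
      (Measure.pi fun _ : Fin (n + 1) => muPos) := by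
    refine Integrable.fintype_prod (f := fun k y => Real.exp (-(τ k * y))) fun k => ?_
    have := exp_neg_integrableOn_Ioi 0 (hτ k)
    simpa [IntegrableOn] using this
  refine (h1.mul_prod h2).mono' (kerK_meas n δ τ).aestronglyMeasurable
    (Filter.Eventually.of_forall fun p => ?_)
  obtain ⟨x, y⟩ := p
  simp only [Function.uncurry, kerK]
  rw [Real.norm_eq_abs, abs_mul, abs_of_nonneg (Finset.prod_nonneg fun k _ => wgt_nonneg n _ k _)]
  refine mul_le_mul_of_nonneg_left ?_ (Finset.prod_nonneg fun k _ => wgt_nonneg n _ k _)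
  rw [Finset.abs_prod]
  refine Finset.prod_le_prod (fun k _ => abs_nonneg _) fun k _ => ?_
  rw [abs_mul, Real.abs_exp, abs_mul]
  refine mul_le_of_le_one_right (Real.exp_pos _).le ?_
  exact mul_le_one₀ (Real.abs_sin_le_one _) (abs_nonneg _) (Real.abs_sin_le_one _)

/-- The reduced integrand. -/
noncomputable def redH (n : ℕ) (δ : Fin (n + 2) → ℝ) (τ : Fin (n + 1) → ℝ)
    (x : Fin (n + 2) → ℝ) : ℝ :=
  Real.sqrt (x 0) * (∏ k, Real.exp (-(δ k / 2 * x k))) *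
    ∏ k : Fin (n + 1), transP (τ k) (x k.castSucc) (x k.succ)

theorem kerK_int_y (n : ℕ) (δ : Fin (n + 2) → ℝ) (τ : Fin (n + 1) → ℝ)
    (hτ : ∀ k, 0 < τ k) (x : Fin (n + 2) → ℝ) (hx : ∀ k, 0 < x k) :
    redH n δ τ x = (Real.pi ^ (n + 1))⁻¹ *
      ∫ y, kerK n δ τ x y ∂(Measure.pi fun _ : Fin (n + 1) => muPos) := by
  unfold kerK redH
  rw [integral_const_mul, integral_fintype_prod_eq_prod (fun k z => Real.exp (-(τ k * z)) *
    (Real.sin (Real.sqrt (x k.castSucc) * z) * Real.sin (Real.sqrt (x k.succ) * z))), wgt_prod]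
  rw [Finset.prod_congr rfl fun k _ => aux_transP (τ k) _ _ (hτ k) (hx k.castSucc) (hx k.succ)]
  rw [Finset.prod_mul_distrib, Finset.prod_mul_distrib, Finset.prod_const, Finset.card_univ,
    Fintype.card_fin, Fin.prod_univ_succ (fun k : Fin (n + 1) => (Real.sqrt (x k.castSucc))⁻¹)]
  have h0 : Real.sqrt (x 0) ≠ 0 := (Real.sqrt_pos.2 (hx 0)).ne'
  simp only [Fin.castSucc_zero, inv_pow]
  field_simp

theorem kerK_int_x (n : ℕ) (δ : Fin (n + 2) → ℝ) (τ : Fin (n + 1) → ℝ)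
    (hδ : ∀ k, 0 < δ k) (y : Fin (n + 1) → ℝ) (hy : ∀ k, 0 < y k) :
    ∫ x, kerK n δ τ x y ∂(Measure.pi fun _ : Fin (n + 2) => muPos) =
      (∏ k, Real.exp (-(τ k * y k))) * (4 * Real.pi ^ (n + 2)) *
      (ellF (δ 0) (y 0) * ellF (δ (Fin.last (n + 1))) (y (Fin.last n)) *
        ∏ k : Fin n, gF (δ k.succ.castSucc) (y k.castSucc) (y k.succ)) := by
  set A : Fin (n + 2) → ℝ → ℝ := fun k x =>
    Fin.cons (α := fun _ => ℝ) 1 (fun j => Real.sin (Real.sqrt x * y j)) k with hA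
  set B : Fin (n + 2) → ℝ → ℝ := fun k x =>
    Fin.snoc (α := fun _ => ℝ) (fun j => Real.sin (Real.sqrt x * y j)) 1 k with hB
  have hK : ∀ x, kerK n δ τ x y = (∏ k, Real.exp (-(τ k * y k))) *
      ∏ k, (wgt n (δ k) k (x k) * (A k (x k) * B k (x k))) := by
    intro x
    unfold kerK
    rw [Finset.prod_mul_distrib, Finset.prod_mul_distrib, Finset.prod_mul_distrib,
      Finset.prod_mul_distrib,
      Fin.prod_univ_succ (fun k => A k (x k)), Fin.prod_univ_castSucc (fun k => B k (x k))]
    simp only [hA, hB, Fin.cons_zero, Fin.cons_succ, Fin.snoc_castSucc, Fin.snoc_last]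
    ring
  simp_rw [hK]
  rw [integral_const_mul, integral_fintype_prod_eq_prod
    (fun k z => wgt n (δ k) k z * (A k z * B k z)), aux_prod_ends]
  have e0 : ∫ z, wgt n (δ 0) 0 z * (A 0 z * B 0 z) ∂muPos = 2 * Real.pi * ellF (δ 0) (y 0) := by
    rw [← aux_ell _ _ (hδ 0) (hy 0)]
    have : ∀ z, B 0 z = Real.sin (Real.sqrt z * y 0) := fun z => by
      have := Fin.snoc_castSucc (α := fun _ => ℝ) (1:ℝ)
        (fun j => Real.sin (Real.sqrt z * y j)) (0 : Fin (n + 1))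
      simpa [hB] using this
    simp_rw [this]
    simp [wgt, hA]
  have e1 : ∫ z, wgt n (δ (Fin.last (n + 1))) (Fin.last (n + 1)) z *
      (A (Fin.last (n + 1)) z * B (Fin.last (n + 1)) z) ∂muPos =
      2 * Real.pi * ellF (δ (Fin.last (n + 1))) (y (Fin.last n)) := by
    rw [← aux_ell _ _ (hδ _) (hy _)]
    have : ∀ z, A (Fin.last (n + 1)) z = Real.sin (Real.sqrt z * y (Fin.last n)) := fun z => by
      simp only [hA]
      rw [← Fin.succ_last, Fin.cons_succ]
    simp_rw [this]
    simp [wgt, hB]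
  have e2 : ∀ k : Fin n, ∫ z, wgt n (δ k.succ.castSucc) k.succ.castSucc z *
      (A k.succ.castSucc z * B k.succ.castSucc z) ∂muPos =
      Real.pi * gF (δ k.succ.castSucc) (y k.castSucc) (y k.succ) := by
    intro k
    rw [← aux_g _ _ _ (hδ _) (hy _) (hy _)]
    have h1 : ∀ z, A k.succ.castSucc z = Real.sin (Real.sqrt z * y k.castSucc) := fun z => by
      simp only [hA]
      rw [← Fin.succ_castSucc, Fin.cons_succ]
    have h2 : ∀ z, B k.succ.castSucc z = Real.sin (Real.sqrt z * y k.succ) := fun z => by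
      simp only [hB]
      rw [Fin.snoc_castSucc]
    have h3 : ¬ (k.succ.castSucc = 0 ∨ k.succ.castSucc = Fin.last (n + 1)) := by
      simp [Fin.ext_iff]
      omega
    simp_rw [h1, h2, wgt, if_neg h3]
  rw [e0, e1, Finset.prod_congr rfl fun k _ => e2 k, Finset.prod_mul_distrib, Finset.prod_const,
    Finset.card_univ, Fintype.card_fin]
  ring

theorem aux_core (n : ℕ) (δ : Fin (n + 2) → ℝ) (τ : Fin (n + 1) → ℝ)
    (hδ : ∀ k, 0 < δ k) (hτ : ∀ k, 0 < τ k) :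
    Integrable (redH n δ τ) (Measure.pi fun _ : Fin (n + 2) => muPos) ∧
    ∫ x, redH n δ τ x ∂(Measure.pi fun _ : Fin (n + 2) => muPos) =
      ∫ y, 4 * Real.pi * ((∏ k, Real.exp (-(τ k * y k))) *
      (ellF (δ 0) (y 0) * ellF (δ (Fin.last (n + 1))) (y (Fin.last n)) *
        ∏ k : Fin n, gF (δ k.succ.castSucc) (y k.castSucc) (y k.succ)))
        ∂(Measure.pi fun _ : Fin (n + 1) => muPos) := by
  have hK := kerK_int n δ τ hδ hτ
  have hae : ∀ᵐ x ∂(Measure.pi fun _ : Fin (n + 2) => muPos), redH n δ τ x =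
      (Real.pi ^ (n + 1))⁻¹ *
      ∫ y, kerK n δ τ x y ∂(Measure.pi fun _ : Fin (n + 1) => muPos) := by
    filter_upwards [aux_ae_pos (n + 2)] with x hx
    exact kerK_int_y n δ τ hτ x hx
  constructor
  · exact (hK.integral_prod_left.const_mul _).congr (hae.mono fun x hx => hx.symm)
  · rw [integral_congr_ae hae, integral_const_mul, integral_integral_swap hK, ← integral_const_mul]
    refine integral_congr_ae ?_
    filter_upwards [aux_ae_pos (n + 1)] with y hy
    rw [kerK_int_x n δ τ hδ y hy]
    have := Real.pi_pos.ne'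
    field_simp
    ring

theorem transP_meas (t : ℝ) : Measurable (fun p : ℝ × ℝ => transP t p.1 p.2) := by
  unfold transP
  fun_prop

theorem transP_nonneg (t x y : ℝ) (ht : 0 < t) (hx : 0 < x) (hy : 0 < y) : 0 ≤ transP t x y := by
  unfold transP
  positivity

theorem aux_first (n : ℕ) (δ : Fin (n + 2) → ℝ) (τ : Fin (n + 1) → ℝ) (r : ℝ)
    (hδ : ∀ k, 0 < δ k) (hτ : ∀ k, 0 < τ k) (hr : 0 < r) (F : (Fin (n + 3) → ℝ) → ℝ)
    (hF : ∀ x, F x = redH n δ τ (fun j => x j.succ) * transP r (x 1) (x 0)) :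
    ∫ x, F x ∂(Measure.pi fun _ : Fin (n + 3) => muPos) =
      ∫ x, redH n δ τ x ∂(Measure.pi fun _ : Fin (n + 2) => muPos) := by
  have mp := measurePreserving_piFinSuccAbove (fun _ : Fin (n + 3) => muPos) 0
  set G : ℝ × (Fin (n + 2) → ℝ) → ℝ := fun p => redH n δ τ p.2 * transP r (p.2 0) p.1 with hG
  have hFG : ∀ x, F x = G (MeasurableEquiv.piFinSuccAbove (fun _ : Fin (n + 3) => ℝ) 0 x) := by
    intro x
    rw [hF]
    rfl
  obtain ⟨hH, -⟩ := aux_core n δ τ hδ hτ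
  have hGm : AEStronglyMeasurable G (muPos.prod (Measure.pi fun _ : Fin (n + 2) => muPos)) := by
    have hm : Measurable (fun p : ℝ × (Fin (n + 2) → ℝ) => (p.2 0, p.1)) := by fun_prop
    exact AEStronglyMeasurable.mul hH.1.comp_snd
      ((transP_meas r).comp hm).aestronglyMeasurable
  have hGi : Integrable G (muPos.prod (Measure.pi fun _ : Fin (n + 2) => muPos)) := by
    rw [integrable_prod_iff' hGm]
    constructor
    · filter_upwards [aux_ae_pos (n + 2)] with x hx
      simp only [hG]
      exact Integrable.const_mul (aux_total r (x 0) hr (hx 0)).1 _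
    · refine hH.norm.congr ?_
      filter_upwards [aux_ae_pos (n + 2)] with x hx
      simp only [hG, norm_mul]
      rw [integral_const_mul]
      have : ∫ a, ‖transP r (x 0) a‖ ∂muPos = 1 := by
        rw [← (aux_total r (x 0) hr (hx 0)).2]
        refine setIntegral_congr_fun measurableSet_Ioi fun z hz => ?_
        exact Real.norm_of_nonneg (transP_nonneg r _ _ hr (hx 0) hz)
      rw [this, mul_one]
  simp_rw [hFG]
  have := mp.integral_comp' G
  refine this.trans ?_
  refine (integral_prod_symm G hGi).trans ?_
  refine integral_congr_ae ?_
  filter_upwards [aux_ae_pos (n + 2)] with x hx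
  simp only [hG]
  rw [integral_const_mul, (aux_total r (x 0) hr (hx 0)).2, mul_one]

/-- **Dual representation of the Brownian excursion, boundary case `t₁ = 0`.**
Here `d = n + 2 ≥ 2`, `s : Fin (n+3) → ℝ` lists `s₀ < … < s_d` with `s₀ = 0`, and
`t : Fin (n+4) → ℝ` lists `t₀, t₁, …, t_d, t_{d+1}` with `t₀ = 0 = t₁`,
`t₁ < t₂ < … < t_d < t_{d+1}` and `t_{d+1} = 1`. -/
theorem excursion_dual_boundary_left (n : ℕ) (s : Fin (n + 3) → ℝ) (t : Fin (n + 4) → ℝ)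
    (hs0 : s 0 = 0) (hs : StrictMono s)
    (ht0 : t 0 = 0) (ht1 : t 1 = 0)
    (htmono : StrictMonoOn t (Set.Ici (1 : Fin (n + 4))))
    (htlast : t (Fin.last (n + 3)) = 1) :
    ((1 / Real.sqrt (2 * Real.pi)) *
        ∫ x : Fin (n + 3) → ℝ in Set.univ.pi fun _ => Set.Ioi (0 : ℝ),
          Real.sqrt (x 0) *
            Real.exp (-(1 / 2 : ℝ) * ∑ k : Fin (n + 3), (t k.succ - t k.castSucc) * x k) *
            ∏ k : Fin (n + 2), transP (s k.succ - s k.castSucc) (x k.castSucc) (x k.succ)) =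
      ∫ y : Fin (n + 1) → ℝ in Set.univ.pi fun _ => Set.Ioi (0 : ℝ),
        Real.exp (-(∑ k : Fin (n + 1), (s k.succ.succ - s k.succ.castSucc) * y k)) *
          excDensity n (fun i => t i.succ.succ.castSucc) y := by
  set δ : Fin (n + 2) → ℝ := fun k => t k.succ.succ - t k.succ.castSucc with hδd
  set τ : Fin (n + 1) → ℝ := fun k => s k.succ.succ - s k.succ.castSucc with hτd
  have hδ : ∀ k, 0 < δ k := fun k => by
    have : t k.succ.castSucc < t k.succ.succ := by
      refine htmono ?_ ?_ ?_
      · simp [Fin.le_def]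
      · simp [Fin.le_def]
      · simp [Fin.lt_def]
    simpa [hδd] using this
  have hτ : ∀ k, 0 < τ k := fun k => by
    have : s k.succ.castSucc < s k.succ.succ := hs (by simp [Fin.lt_def])
    simpa [hτd] using this
  have hr : 0 < s 1 - s 0 := sub_pos.2 (hs (by simp [Fin.lt_def]))
  have hvol : ∀ m : ℕ, (volume : Measure (Fin m → ℝ)).restrict
      (Set.univ.pi fun _ => Set.Ioi (0:ℝ)) = Measure.pi fun _ : Fin m => muPos := by
    intro m
    rw [volume_pi, Measure.restrict_pi_pi]
  rw [hvol, hvol, aux_first n δ τ (s 1 - s 0) hδ hτ hr, (aux_core n δ τ hδ hτ).2,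
    ← integral_const_mul]
  · congr 1
    ext y
    have e1 : Real.exp (-∑ k : Fin (n + 1), (s k.succ.succ - s k.succ.castSucc) * y k) =
        ∏ k, Real.exp (-(τ k * y k)) := by
      rw [← Finset.sum_neg_distrib, Real.exp_sum]
    have e2 : Real.sqrt (8 * Real.pi) = 1 / Real.sqrt (2 * Real.pi) * (4 * Real.pi) := by
      have h : 0 < Real.sqrt (2 * Real.pi) := by positivity
      rw [one_div, inv_mul_eq_div, eq_div_iff h.ne', ← Real.sqrt_mul (by positivity),
        show 8 * Real.pi * (2 * Real.pi) = (4 * Real.pi) ^ 2 by ring,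
        Real.sqrt_sq (by positivity)]
    have e3 : t (Fin.succ (Fin.succ (0 : Fin (n + 1)))).castSucc = δ 0 := by
      simp only [hδd]
      have : t (Fin.castSucc (Fin.succ (0 : Fin (n + 2)))) = 0 := ht1
      rw [this, sub_zero]
      rfl
    have e4 : 1 - t (Fin.succ (Fin.succ (Fin.last n))).castSucc = δ (Fin.last (n + 1)) := by
      simp only [hδd]
      rw [← htlast]
      rfl
    rw [e1, excDensity, e2]
    rw [e3, e4]
    have e5 : ∀ k : Fin n, t k.succ.succ.succ.castSucc - t k.castSucc.succ.succ.castSucc =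
      δ k.succ.castSucc := fun k => rfl
    simp only [e5]
    ring
  · intro x
    have e1 : Real.exp (-(1 / 2 : ℝ) * ∑ k : Fin (n + 3), (t k.succ - t k.castSucc) * x k) =
        ∏ k, Real.exp (-(δ k / 2 * x k.succ)) := by
      rw [Fin.sum_univ_succ, ← Real.exp_sum]
      have : t (Fin.succ (0 : Fin (n + 3))) = 0 := ht1
      rw [this, Fin.castSucc_zero, ht0, sub_self, zero_mul, zero_add, Finset.mul_sum]
      congr 1
      refine Finset.sum_congr rfl fun k _ => ?_
      simp only [hδd]
      ring
    have e2 := aux_symm (s 1 - s 0) (x 0) (x 1)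
    rw [e1, Fin.prod_univ_succ (fun k : Fin (n + 2) =>
      transP (s k.succ - s k.castSucc) (x k.castSucc) (x k.succ)), redH]
    have e3 : transP (s (Fin.succ (0 : Fin (n + 2))) - s (Fin.castSucc (0 : Fin (n + 2))))
      (x (Fin.castSucc (0 : Fin (n + 2)))) (x (Fin.succ (0 : Fin (n + 2)))) =
      transP (s 1 - s 0) (x 0) (x 1) := rfl
    rw [e3]
    have e4 : x (Fin.succ (0 : Fin (n + 2))) = x 1 := rfl
    have e5 : ∀ k : Fin (n + 1), transP (s k.succ.succ - s k.succ.castSucc) (x k.succ.castSucc)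
      (x k.succ.succ) = transP (τ k) (x k.castSucc.succ) (x k.succ.succ) := fun k => rfl
    simp only [e4, e5]
    linear_combination (∏ k, Real.exp (-(δ k / 2 * x k.succ))) *
      (∏ k : Fin (n + 1), transP (τ k) (x k.castSucc.succ) (x k.succ.succ)) * e2
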